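/- arXiv:2502.04267 — 2 statements merged into one kernel-verified Lean document; each statement's English description precedes it below -/
import Mathlib

section
/- Let H be a finite-dimensional quasitriangular Hopf algebra and consider the algebra L₀,₁(H) on H*. For every φ ∈ H* and every ψ ∈ H* satisfying ψ(xy) = ψ(y·S²(x)) for all x, y ∈ H, one has φ·ψ = φ ⋆ ψ = ψ·φ, where · is the product of L₀,₁(H) and ⋆ is the convolution product. In particular, every such ψ lies in the center of L₀,₁(H). -/
/-!
Statement 9: Let `H` be a finite-dimensional quasitriangular Hopf algebra and consider the
algebra `L₀,₁(H)` on `H*`.  For every `φ ∈ H*` and every `ψ ∈ H*` with `ψ(xy) = ψ(y·S²(x))`,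
one has `φ·ψ = φ ⋆ ψ = ψ·φ` (where `·` is the product of `L₀,₁(H)` and `⋆` the convolution
product); in particular every such `ψ` lies in the center of `L₀,₁(H)`.
-/

open TensorProduct MulOpposite

noncomputable section

/-- An element `R = ∑ i, a i ⊗ b i` of `H ⊗ H` presented by finite families of components
(`a i` are the `R₍₁₎`-components, `b i` the `R₍₂₎`-components, with implicit summation). -/
structure RMat (k H : Type*) [CommSemiring k] [AddCommMonoid H] [Module k H] where
  m : ℕ
  a : Fin m → H
  b : Fin m → H

/-- A quasitriangular structure on the Hopf algebra `H`: the antipode is bijective (with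
explicit inverse `Sinv`), and `R = ∑ i, a i ⊗ b i` is an invertible element of `H ⊗ H`
satisfying quasi-cocommutativity `R·Δ(h) = Δᵒᵖ(h)·R` and the quasitriangularity axioms
`(Δ ⊗ id)(R) = R₁₃·R₂₃` and `(id ⊗ Δ)(R) = R₁₃·R₁₂` (in `H ⊗ (H ⊗ H)`). -/
structure QT (k H : Type*) [Field k] [Ring H] [HopfAlgebra k H] extends RMat k H where
  Sinv : H →ₗ[k] H
  Sinv_antipode : ∀ h : H, Sinv (HopfAlgebra.antipode (R := k) h) = h
  antipode_Sinv : ∀ h : H, HopfAlgebra.antipode (R := k) (Sinv h) = h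
  isUnit_el : IsUnit (∑ i, a i ⊗ₜ[k] b i : H ⊗[k] H)
  qcc : ∀ h : H,
    (∑ i, a i ⊗ₜ[k] b i : H ⊗[k] H) * Coalgebra.comul (R := k) h =
      (TensorProduct.comm k H H) (Coalgebra.comul (R := k) h) * ∑ i, a i ⊗ₜ[k] b i
  qt_rTensor : (TensorProduct.assoc k H H H)
      (TensorProduct.map (Coalgebra.comul (R := k) (A := H)) LinearMap.id
        (∑ i, a i ⊗ₜ[k] b i)) =
    (∑ i, a i ⊗ₜ[k] ((1 : H) ⊗ₜ[k] b i)) * ∑ i, (1 : H) ⊗ₜ[k] (a i ⊗ₜ[k] b i)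
  qt_lTensor : TensorProduct.map LinearMap.id (Coalgebra.comul (R := k) (A := H))
      (∑ i, a i ⊗ₜ[k] b i) =
    (∑ i, a i ⊗ₜ[k] ((1 : H) ⊗ₜ[k] b i)) * ∑ i, a i ⊗ₜ[k] (b i ⊗ₜ[k] (1 : H))

variable {k H : Type*} [Field k] [Ring H] [HopfAlgebra k H]

/-- The map `Φ₀,₁ : H* → H`, `φ ↦ (φ ⊗ id)(R·R₂₁) = φ(R¹₍₁₎ R²₍₂₎) R¹₍₂₎ R²₍₁₎`. -/
def RMat.phi (Q : RMat k H) (φ : Module.Dual k H) : H :=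
  ∑ i, ∑ j, φ (Q.a i * Q.b j) • (Q.b i * Q.a j)

/-- The convolution product on `H*`: `(φ ⋆ ψ)(h) = φ(h₍₁₎)ψ(h₍₂₎)`. -/
def conv (φ ψ : Module.Dual k H) : Module.Dual k H :=
  TensorProduct.lift ((LinearMap.mul k k).compl₁₂ φ ψ) ∘ₗ
    (Coalgebra.comul (R := k) (A := H))

/-- The product of `L₀,₁(H)` on `H*`:
`(φ·ψ)(h) = φ(h₍₁₎ R²₍₂₎ S(R¹₍₂₎)) ψ(R¹₍₁₎ h₍₂₎ R²₍₁₎)` (`R¹` indexed by `i`, `R²` by `j`). -/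
def RMat.lmul (Q : RMat k H) (φ ψ : Module.Dual k H) : Module.Dual k H :=
  ∑ i, ∑ j,
    conv (φ ∘ₗ LinearMap.mulRight k (Q.b j * HopfAlgebra.antipode (R := k) (Q.b i)))
      (ψ ∘ₗ LinearMap.mulLeft k (Q.a i) ∘ₗ LinearMap.mulRight k (Q.a j))

/-- The bilinear map `(h₁, h₂) ↦ (x ↦ h₁ * x * S(h₂))`. -/
def conjBil (k H : Type*) [Field k] [Ring H] [HopfAlgebra k H] :
    H →ₗ[k] H →ₗ[k] (H →ₗ[k] H) :=
  ((LinearMap.llcomp k H H H).comp (LinearMap.mul k H)).compl₂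
    ((LinearMap.mul k H).flip ∘ₗ HopfAlgebra.antipode (R := k))

/-- The right coadjoint action of `H` on `H*`: `coad(h)(φ) = φ(h₍₁₎ ? S(h₍₂₎))`. -/
def coad (h : H) (φ : Module.Dual k H) : Module.Dual k H :=
  φ ∘ₗ TensorProduct.lift (conjBil k H) (Coalgebra.comul (R := k) h)

/-- The inverse `u⁻¹ = S⁻²(R₍₂₎)R₍₁₎` of the Drinfeld element `u = S(R₍₂₎)R₍₁₎`. -/
def QT.uinv (Q : QT k H) : H := ∑ i, Q.Sinv (Q.Sinv (Q.b i)) * Q.a i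

/-- The antipode `S_L` of the braided dual `L₀,₁(H)`:
`S_L(φ)(h) = φ(R₍₂₎ u⁻¹ S(h) S(R₍₁₎))`. -/
def QT.sL (Q : QT k H) (φ : Module.Dual k H) : Module.Dual k H :=
  ∑ i, φ ∘ₗ (LinearMap.mulLeft k (Q.b i * Q.uinv) ∘ₗ
    LinearMap.mulRight k (HopfAlgebra.antipode (R := k) (Q.a i)) ∘ₗ
      HopfAlgebra.antipode (R := k))

open HopfAlgebra Coalgebra

/-- The element `R = ∑ i, a i ⊗ b i` of `H ⊗ H`. -/
def RMat.el (Q : RMat k H) : H ⊗[k] H := ∑ i, Q.a i ⊗ₜ[k] Q.b i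

/-- The pairing `x ⊗ y ↦ φ(x)ψ(y)`. -/
def pairing (φ ψ : Module.Dual k H) : H ⊗[k] H →ₗ[k] k :=
  TensorProduct.lift ((LinearMap.mul k k).compl₁₂ φ ψ)

lemma pairing_tmul (φ ψ : Module.Dual k H) (x y : H) : pairing φ ψ (x ⊗ₜ y) = φ x * ψ y := rfl

lemma conv_apply (φ ψ : Module.Dual k H) (h : H) : conv φ ψ h = pairing φ ψ (comul h) := rfl

lemma pairing_comm (φ ψ : Module.Dual k H) (t : H ⊗[k] H) :
    pairing ψ φ (TensorProduct.comm k H H t) = pairing φ ψ t := by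
  induction t with
  | zero => simp
  | tmul x y => simp [pairing_tmul, mul_comm]
  | add s t hs ht => simp only [map_add, hs, ht]

namespace QT

variable (Q : QT k H)

lemma isUnit_toRMat_el : IsUnit Q.toRMat.el := Q.isUnit_el

lemma el_mul_comul (h : H) :
    Q.toRMat.el * comul (R := k) h = TensorProduct.comm k H H (comul (R := k) h) * Q.toRMat.el :=
  Q.qcc h

/-- `(Δ ⊗ id)(R) = R₁₃·R₂₃` in components. -/
lemma map_comul_id_el :
    TensorProduct.map (comul (R := k) (A := H)) LinearMap.id Q.toRMat.el =
      ∑ i, ∑ j, (Q.a i ⊗ₜ[k] Q.a j) ⊗ₜ[k] (Q.b i * Q.b j) := by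
  apply (TensorProduct.assoc k H H H).injective
  refine Q.qt_rTensor.trans ?_
  simp [Finset.sum_mul_sum]

/-- `(id ⊗ Δ)(R) = R₁₃·R₁₂` in components. -/
lemma map_id_comul_el :
    TensorProduct.map LinearMap.id (comul (R := k) (A := H)) Q.toRMat.el =
      ∑ i, ∑ j, (Q.a i * Q.a j) ⊗ₜ[k] (Q.b j ⊗ₜ[k] Q.b i) := by
  refine Q.qt_lTensor.trans ?_
  simp [Finset.sum_mul_sum]

/-- Applying `f : H ⊗ H → H` to the first two legs of `(Δ ⊗ id)(R) = R₁₃·R₂₃`. -/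
lemma map_comp_comul_id_el (f : H ⊗[k] H →ₗ[k] H) :
    TensorProduct.map (f ∘ₗ comul) LinearMap.id Q.toRMat.el =
      ∑ i, ∑ j, f (Q.a i ⊗ₜ[k] Q.a j) ⊗ₜ[k] (Q.b i * Q.b j) := by
  have h := congrArg (TensorProduct.map f LinearMap.id) Q.map_comul_id_el
  rw [← LinearMap.comp_apply, ← TensorProduct.map_comp] at h
  simpa using h

/-- Applying `f : H ⊗ H → H` to the last two legs of `(id ⊗ Δ)(R) = R₁₃·R₁₂`. -/
lemma map_id_comp_comul_el (f : H ⊗[k] H →ₗ[k] H) :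
    TensorProduct.map LinearMap.id (f ∘ₗ comul) Q.toRMat.el =
      ∑ i, ∑ j, (Q.a i * Q.a j) ⊗ₜ[k] f (Q.b j ⊗ₜ[k] Q.b i) := by
  have h := congrArg (TensorProduct.map LinearMap.id f) Q.map_id_comul_el
  rw [← LinearMap.comp_apply, ← TensorProduct.map_comp] at h
  simpa using h

/-- `(ε ⊗ id)(R) = 1`. -/
lemma map_counit_id_el :
    TensorProduct.map (Algebra.linearMap k H ∘ₗ counit) LinearMap.id Q.toRMat.el = 1 := by
  apply Q.isUnit_toRMat_el.mul_right_cancel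
  have h := Q.map_comp_comul_id_el
    ((TensorProduct.lid k H).toLinearMap ∘ₗ (counit (R := k) (A := H)).rTensor H)
  have hid : ((TensorProduct.lid k H).toLinearMap ∘ₗ (counit (R := k) (A := H)).rTensor H) ∘ₗ
      comul = LinearMap.id := by
    ext x; simp
  rw [hid, TensorProduct.map_id, LinearMap.id_apply] at h
  rw [one_mul]
  nth_rw 3 [h]
  simp [RMat.el, Finset.sum_mul_sum, Algebra.smul_def]

/-- `(id ⊗ ε)(R) = 1`. -/
lemma map_id_counit_el :
    TensorProduct.map LinearMap.id (Algebra.linearMap k H ∘ₗ counit) Q.toRMat.el = 1 := by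
  apply Q.isUnit_toRMat_el.mul_right_cancel
  have h := Q.map_id_comp_comul_el
    ((TensorProduct.rid k H).toLinearMap ∘ₗ (counit (R := k) (A := H)).lTensor H)
  have hid : ((TensorProduct.rid k H).toLinearMap ∘ₗ (counit (R := k) (A := H)).lTensor H) ∘ₗ
      comul = LinearMap.id := by
    ext x; simp
  rw [hid, TensorProduct.map_id, LinearMap.id_apply] at h
  rw [one_mul]
  nth_rw 3 [h]
  simp [RMat.el, Finset.sum_mul_sum, Algebra.smul_def]

/-- `(S ⊗ id)(R)·R = 1`. -/
lemma map_antipode_id_el_mul_el :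
    TensorProduct.map (antipode k) LinearMap.id Q.toRMat.el * Q.toRMat.el = 1 := by
  have h := Q.map_comp_comul_id_el (LinearMap.mul' k H ∘ₗ (antipode k).rTensor H)
  rw [LinearMap.comp_assoc, mul_antipode_rTensor_comul, Q.map_counit_id_el] at h
  rw [h]
  simp [RMat.el, Finset.sum_mul_sum]

/-- `S⁻¹(h₍₂₎)h₍₁₎ = ε(h)`. -/
lemma mul_comm_Sinv_lTensor_comul :
    (LinearMap.mul' k H ∘ₗ (TensorProduct.comm k H H).toLinearMap ∘ₗ Q.Sinv.lTensor H) ∘ₗ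
      comul = Algebra.linearMap k H ∘ₗ counit := by
  have key : antipode k ∘ₗ
      (LinearMap.mul' k H ∘ₗ (TensorProduct.comm k H H).toLinearMap ∘ₗ Q.Sinv.lTensor H) =
      LinearMap.mul' k H ∘ₗ (antipode k).rTensor H := by
    ext x y
    simp [antipode_mul_antidistrib, Q.antipode_Sinv]
  ext x
  apply Function.LeftInverse.injective Q.Sinv_antipode
  have h := LinearMap.congr_fun key (comul x)
  have hx := mul_antipode_rTensor_comul_apply (R := k) x
  simp only [LinearMap.comp_apply] at h hx ⊢
  rw [h, hx]
  simp [Algebra.algebraMap_eq_smul_one]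

/-- `(id ⊗ S⁻¹)(R)·R = 1`. -/
lemma map_id_Sinv_el_mul_el :
    TensorProduct.map LinearMap.id Q.Sinv Q.toRMat.el * Q.toRMat.el = 1 := by
  have h := Q.map_id_comp_comul_el
    (LinearMap.mul' k H ∘ₗ (TensorProduct.comm k H H).toLinearMap ∘ₗ Q.Sinv.lTensor H)
  rw [Q.mul_comm_Sinv_lTensor_comul, Q.map_id_counit_el] at h
  rw [h]
  simp [RMat.el, Finset.sum_mul_sum]

/-- `(S ⊗ S)(R) = R`. -/
lemma map_antipode_antipode_el :
    TensorProduct.map (antipode k) (antipode k) Q.toRMat.el = Q.toRMat.el := by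
  have h : TensorProduct.map (antipode k) LinearMap.id Q.toRMat.el =
      TensorProduct.map LinearMap.id Q.Sinv Q.toRMat.el :=
    Q.isUnit_toRMat_el.mul_right_cancel
      (Q.map_antipode_id_el_mul_el.trans Q.map_id_Sinv_el_mul_el.symm)
  have hmap := congrArg (TensorProduct.map LinearMap.id (antipode k)) h
  simpa [RMat.el, Q.antipode_Sinv] using hmap

/-- `R·(S² ⊗ S)(R) = 1`. -/
lemma el_mul_map_antipode_sq_antipode_el :
    Q.toRMat.el *
      TensorProduct.map (antipode k ∘ₗ antipode k) (antipode k) Q.toRMat.el = 1 := by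
  have h : TensorProduct.map (antipode k ∘ₗ antipode k) (antipode k) Q.toRMat.el =
      TensorProduct.map (antipode k) LinearMap.id Q.toRMat.el := by
    conv_rhs => rw [← Q.map_antipode_antipode_el]
    simp [RMat.el]
  rw [h]
  apply Q.isUnit_toRMat_el.mul_right_cancel
  rw [mul_assoc, Q.map_antipode_id_el_mul_el, mul_one, one_mul]

/-- If `ψ(xy) = ψ(y·S²(x))`, then `φ·ψ = φ ⋆ ψ`. -/
lemma lmul_eq_conv (φ ψ : Module.Dual k H)
    (hψ : ∀ x y : H, ψ (x * y) = ψ (y * antipode k (antipode k x))) :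
    Q.toRMat.lmul φ ψ = conv φ ψ := by
  have key (t : H ⊗[k] H) :
      ∑ i, ∑ j, pairing (φ ∘ₗ LinearMap.mulRight k (Q.b j * antipode k (Q.b i)))
        (ψ ∘ₗ LinearMap.mulLeft k (Q.a i) ∘ₗ LinearMap.mulRight k (Q.a j)) t =
      pairing ψ φ (TensorProduct.comm k H H t * (Q.toRMat.el *
        TensorProduct.map (antipode k ∘ₗ antipode k) (antipode k) Q.toRMat.el)) := by
    induction t with
    | zero => simp
    | tmul x y =>
      simp [RMat.el, Finset.sum_mul, Finset.mul_sum, pairing_tmul, hψ (Q.a _), mul_assoc,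
        mul_comm (ψ _)]
    | add s t hs ht => simp only [map_add, add_mul, Finset.sum_add_distrib, hs, ht]
  ext h
  simp only [RMat.lmul, LinearMap.sum_apply, conv_apply]
  rw [key, Q.el_mul_map_antipode_sq_antipode_el, mul_one, pairing_comm]

/-- If `ψ(xy) = ψ(y·S²(x))`, then `ψ·φ = φ ⋆ ψ`. -/
lemma lmul_eq_conv_swap (φ ψ : Module.Dual k H)
    (hψ : ∀ x y : H, ψ (x * y) = ψ (y * antipode k (antipode k x))) :
    Q.toRMat.lmul ψ φ = conv φ ψ := by
  have hSinv (x y : H) : ψ (x * antipode k y) = ψ (Q.Sinv y * x) := by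
    rw [hψ (Q.Sinv y), Q.antipode_Sinv]
  have key (t : H ⊗[k] H) :
      ∑ i, ∑ j, pairing (ψ ∘ₗ LinearMap.mulRight k (Q.b j * antipode k (Q.b i)))
        (φ ∘ₗ LinearMap.mulLeft k (Q.a i) ∘ₗ LinearMap.mulRight k (Q.a j)) t =
      pairing φ ψ (TensorProduct.map LinearMap.id Q.Sinv Q.toRMat.el *
        (TensorProduct.comm k H H t * Q.toRMat.el)) := by
    induction t with
    | zero => simp
    | tmul x y =>
      rw [Finset.sum_comm]
      simp [RMat.el, Finset.sum_mul, Finset.mul_sum, pairing_tmul, ← mul_assoc, hSinv,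
        mul_comm (φ _)]
    | add s t hs ht => simp only [map_add, add_mul, mul_add, Finset.sum_add_distrib, hs, ht]
  ext h
  simp only [RMat.lmul, LinearMap.sum_apply, conv_apply]
  rw [key, ← Q.el_mul_comul, ← mul_assoc, Q.map_id_Sinv_el_mul_el, one_mul]

end QT

theorem statement9
    {k H : Type*} [Field k] [Ring H] [HopfAlgebra k H] [FiniteDimensional k H]
    (Q : QT k H)
    (φ ψ : Module.Dual k H)
    (hψ : ∀ x y : H,
      ψ (x * y) = ψ (y * HopfAlgebra.antipode (R := k) (HopfAlgebra.antipode (R := k) x))) :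
    Q.toRMat.lmul φ ψ = conv φ ψ ∧ conv φ ψ = Q.toRMat.lmul ψ φ ∧
    -- in particular, `ψ` is central in `L₀,₁(H)`:
    ∀ χ : Module.Dual k H, Q.toRMat.lmul χ ψ = Q.toRMat.lmul ψ χ := by
  have hl (χ : Module.Dual k H) := Q.lmul_eq_conv χ ψ hψ
  have hr (χ : Module.Dual k H) := Q.lmul_eq_conv_swap χ ψ hψ
  exact ⟨hl φ, (hr φ).symm, fun χ => (hl χ).trans (hr χ).symm⟩

end
end

section
/- Let H be a finite-dimensional quasitriangular Hopf algebra with Drinfeld element u = S(R₍₂₎)R₍₁₎. Then Φ₀,₁ intertwines the dual coproduct and antipode with their braided counterparts: (Φ₀,₁ ⊗ Φ₀,₁)(Δ_{H*}(φ)) = Δ̲(Φ₀,₁(φ)) and Φ₀,₁(S_{L}(φ)) = S̲(Φ₀,₁(φ)) for all φ ∈ H*, where Δ_{H*} is the coproduct on H* dual to the multiplication of H (characterized by Σ φ₍₁₎(x) φ₍₂₎(y) = φ(xy), using the canonical isomorphism H* ⊗ H* ≅ (H ⊗ H)* valid since H is finite-dimensional), Δ̲(h) = R¹₍₁₎ h₍₁₎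 R²₍₁₎ ⊗ S(R²₍₂₎) R¹₍₂₎ h₍₂₎ is the braided coproduct on H, S_{L}(φ) is the linear form h ↦ φ(R₍₂₎ u⁻¹ S(h) S(R₍₁₎)), and S̲(h) = S(R₍₂₎ u⁻¹ h S(R₍₁₎)) is the braided antipode. -/
/-!
Statement 14: Let `H` be a finite-dimensional quasitriangular Hopf algebra with Drinfeld
element `u = S(R₍₂₎)R₍₁₎`.  Then `Φ₀,₁` intertwines the dual coproduct and antipode with their
braided counterparts: `(Φ₀,₁ ⊗ Φ₀,₁)(Δ_{H*}(φ)) = Δ̲(Φ₀,₁(φ))` and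
`Φ₀,₁(S_L(φ)) = S̲(Φ₀,₁(φ))`, where `Δ̲(h) = R¹₍₁₎ h₍₁₎ R²₍₁₎ ⊗ S(R²₍₂₎) R¹₍₂₎ h₍₂₎`,
`S_L(φ)(h) = φ(R₍₂₎ u⁻¹ S(h) S(R₍₁₎))` and `S̲(h) = S(R₍₂₎ u⁻¹ h S(R₍₁₎))`.

`Δ_{H*}(φ)` is characterized (via `H* ⊗ H* ≅ (H ⊗ H)*`, valid in finite dimension) by
`Σ φ₍₁₎(x) φ₍₂₎(y) = φ(xy)`; accordingly the first identity is stated for every finite family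
`(p j, q j)` representing `φ ∘ mul` in this way.
-/

open TensorProduct MulOpposite

noncomputable section

variable {k H : Type*} [Field k] [Ring H] [HopfAlgebra k H]

/-- The braided coproduct `Δ̲(h) = R¹₍₁₎ h₍₁₎ R²₍₁₎ ⊗ S(R²₍₂₎) R¹₍₂₎ h₍₂₎` on `H`
(`R¹` indexed by `i`, `R²` by `j`). -/
def QT.brComul (Q : QT k H) (h : H) : H ⊗[k] H :=
  ∑ i, ∑ j,
    TensorProduct.map
      (LinearMap.mulLeft k (Q.a i) ∘ₗ LinearMap.mulRight k (Q.a j))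
      (LinearMap.mulLeft k (HopfAlgebra.antipode (R := k) (Q.b j) * Q.b i))
      (Coalgebra.comul (R := k) h)

/-- The braided antipode `S̲(h) = S(R₍₂₎ u⁻¹ h S(R₍₁₎))` on `H`. -/
def QT.brS (Q : QT k H) (h : H) : H :=
  ∑ i, HopfAlgebra.antipode (R := k)
    (Q.b i * Q.uinv * h * HopfAlgebra.antipode (R := k) (Q.a i))

namespace QT

open HopfAlgebra Coalgebra

section Placements

variable {E : Type*} [Ring E] [Algebra k E]

/-- The image of `R` in an algebra `E` under a pair of algebra maps `H → E`. -/
def el (Q : QT k H) (f g : H →ₐ[k] E) : E := ∑ i, f (Q.a i) * g (Q.b i)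

/-- The image of `(S ⊗ id)(R)` in an algebra `E` under a pair of algebra maps `H → E`. -/
def elInv (Q : QT k H) (f g : H →ₐ[k] E) : E := ∑ i, f (antipode k (Q.a i)) * g (Q.b i)

variable (Q : QT k H) {f g h : H →ₐ[k] E}

theorem lift_eq_el (hfg : ∀ x y, Commute (f x) (g y)) :
    Algebra.TensorProduct.lift f g hfg (∑ i, Q.a i ⊗ₜ[k] Q.b i) = Q.el f g := by
  simp [el]

theorem sum_lift_comul_mul (hfg : ∀ x y, Commute (f x) (g y)) (hfh : ∀ x y, Commute (f x) (h y))
    (hgh : ∀ x y, Commute (g x) (h y)) :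
    ∑ i, Algebra.TensorProduct.lift f g hfg (comul (R := k) (Q.a i)) * h (Q.b i) =
      Q.el f h * Q.el g h := by
  have hc : ∀ x y, Commute (f x) (Algebra.TensorProduct.lift g h hgh y) := fun x y ↦ by
    induction y with
    | zero => simp
    | tmul y z => simpa using (hfg x y).mul_right (hfh x z)
    | add y z hy hz => simpa using hy.add_right hz
  have key : ∀ (t : H ⊗[k] H) (z : H),
      Algebra.TensorProduct.lift f (Algebra.TensorProduct.lift g h hgh) hc
        (TensorProduct.assoc k H H H (t ⊗ₜ z)) = Algebra.TensorProduct.lift f g hfg t * h z := by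
    intro t z
    induction t with
    | zero => simp
    | tmul x y => simp [mul_assoc]
    | add x y hx hy => simp only [TensorProduct.add_tmul, map_add, hx, hy, add_mul]
  have := congrArg (Algebra.TensorProduct.lift f (Algebra.TensorProduct.lift g h hgh) hc)
    Q.qt_rTensor
  simpa [map_sum, key, el] using this

theorem sum_mul_lift_comul (hfg : ∀ x y, Commute (f x) (g y)) (hfh : ∀ x y, Commute (f x) (h y))
    (hgh : ∀ x y, Commute (g x) (h y)) :
    ∑ i, f (Q.a i) * Algebra.TensorProduct.lift g h hgh (comul (R := k) (Q.b i)) =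
      Q.el f h * Q.el f g := by
  have hc : ∀ x y, Commute (f x) (Algebra.TensorProduct.lift g h hgh y) := fun x y ↦ by
    induction y with
    | zero => simp
    | tmul y z => simpa using (hfg x y).mul_right (hfh x z)
    | add y z hy hz => simpa using hy.add_right hz
  have := congrArg (Algebra.TensorProduct.lift f (Algebra.TensorProduct.lift g h hgh) hc)
    Q.qt_lTensor
  simpa [map_sum, el] using this

/-- The Yang–Baxter equation `R₁₂ R₁₃ R₂₃ = R₂₃ R₁₃ R₁₂`. -/
theorem yang_baxter (hfg : ∀ x y, Commute (f x) (g y)) (hfh : ∀ x y, Commute (f x) (h y))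
    (hgh : ∀ x y, Commute (g x) (h y)) :
    Q.el f g * Q.el f h * Q.el g h = Q.el g h * Q.el f h * Q.el f g := by
  have hgf : ∀ x y, Commute (g x) (f y) := fun x y ↦ (hfg y x).symm
  have hcomm : ∀ t : H ⊗[k] H, Algebra.TensorProduct.lift f g hfg (TensorProduct.comm k H H t) =
      Algebra.TensorProduct.lift g f hgf t := fun t ↦ by
    induction t with
    | zero => simp
    | tmul x y => simp [(hfg y x).eq]
    | add x y hx hy => simp [hx, hy]
  have hcoh : ∀ y, Commute (Q.el f g) (h y) := fun y ↦
    Commute.sum_left _ _ _ fun i _ ↦ (hfh _ y).mul_left (hgh _ y)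
  rw [mul_assoc, ← Q.sum_lift_comul_mul hfg hfh hgh, ← Q.sum_lift_comul_mul hgf hgh hfh,
    Finset.mul_sum, Finset.sum_mul]
  refine Finset.sum_congr rfl fun i _ ↦ ?_
  have := congrArg (Algebra.TensorProduct.lift f g hfg) (Q.qcc (Q.a i))
  rw [map_mul, map_mul, hcomm, lift_eq_el] at this
  rw [← mul_assoc, this, mul_assoc, mul_assoc, (hcoh _).eq]

end Placements

section Counit

variable (Q : QT k H)

theorem sum_counit_smul_b : ∑ i, counit (R := k) (Q.a i) • Q.b i = 1 := by
  have h := congrArg (TensorProduct.lid k (H ⊗[k] H) ∘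
    TensorProduct.map (counit (R := k) (A := H)) LinearMap.id) Q.qt_rTensor
  have key : ∀ (t : H ⊗[k] H) (z : H), TensorProduct.lid k (H ⊗[k] H)
      (TensorProduct.map (counit (R := k) (A := H)) LinearMap.id
        (TensorProduct.assoc k H H H (t ⊗ₜ z))) =
      TensorProduct.lid k H (counit.rTensor H t) ⊗ₜ z := by
    intro t z
    induction t with
    | zero => simp
    | tmul x y => simp [TensorProduct.smul_tmul']
    | add x y hx hy => simp only [TensorProduct.add_tmul, map_add, hx, hy]
  have h2 : ((1 : H) ⊗ₜ[k] ∑ i, counit (R := k) (Q.a i) • Q.b i) *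
      ∑ i, Q.a i ⊗ₜ[k] Q.b i = ∑ i, Q.a i ⊗ₜ[k] Q.b i := by
    simp only [Function.comp_apply, map_sum, TensorProduct.map_tmul, key,
      Finset.sum_mul_sum, Algebra.TensorProduct.tmul_mul_tmul, LinearMap.id_apply,
      Coalgebra.rTensor_counit_comul, TensorProduct.lid_tmul, one_smul, mul_one, one_mul] at h
    refine Eq.trans ?_ h.symm
    simp [TensorProduct.tmul_sum, Finset.sum_mul_sum, TensorProduct.tmul_smul]
  have h3 := Q.isUnit_el.mul_right_cancel (h2.trans (one_mul _).symm)
  simpa [Algebra.TensorProduct.one_def] using congrArg (LinearMap.mul' k H) h3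

theorem sum_counit_smul_a : ∑ i, counit (R := k) (Q.b i) • Q.a i = 1 := by
  have h := congrArg (TensorProduct.map (LinearMap.id : H →ₗ[k] H)
    ((TensorProduct.lid k H).toLinearMap ∘ₗ counit.rTensor H)) Q.qt_lTensor
  have h2 : (∑ i, Q.a i ⊗ₜ[k] Q.b i) *
      ((∑ i, counit (R := k) (Q.b i) • Q.a i) ⊗ₜ[k] (1 : H)) = ∑ i, Q.a i ⊗ₜ[k] Q.b i := by
    simp only [map_sum, TensorProduct.map_tmul, Finset.sum_mul_sum,
      Algebra.TensorProduct.tmul_mul_tmul, LinearMap.id_apply, LinearMap.comp_apply,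
      LinearEquiv.coe_coe, LinearMap.rTensor_tmul, Coalgebra.rTensor_counit_comul,
      TensorProduct.lid_tmul, one_smul, mul_one, one_mul] at h
    refine Eq.trans ?_ h.symm
    simp [TensorProduct.sum_tmul, Finset.sum_mul_sum, TensorProduct.tmul_smul,
      TensorProduct.smul_tmul']
  have h3 := Q.isUnit_el.mul_left_cancel (h2.trans (mul_one _).symm)
  simpa [Algebra.TensorProduct.one_def] using congrArg (LinearMap.mul' k H) h3

theorem sum_antipode_a_mul_a :
    ∑ i, ∑ j, (antipode k (Q.a i) * Q.a j) ⊗ₜ[k] (Q.b i * Q.b j) = 1 := by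
  have h := congrArg (TensorProduct.map (LinearMap.mul' k H ∘ₗ (antipode k).rTensor H)
    LinearMap.id ∘ (TensorProduct.assoc k H H H).symm) Q.qt_rTensor
  simp only [Function.comp_apply, LinearEquiv.symm_apply_apply, map_sum, TensorProduct.map_tmul,
    LinearMap.comp_apply, mul_antipode_rTensor_comul_apply, Finset.sum_mul_sum,
    Algebra.TensorProduct.tmul_mul_tmul, mul_one, one_mul, TensorProduct.assoc_symm_tmul,
    LinearMap.rTensor_tmul, LinearMap.mul'_apply, LinearMap.id_apply] at h
  rw [← h]
  simp only [Algebra.algebraMap_eq_smul_one, TensorProduct.smul_tmul, ← TensorProduct.tmul_sum,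
    sum_counit_smul_b, Algebra.TensorProduct.one_def]

theorem sum_a_mul_antipode_a :
    ∑ i, ∑ j, (Q.a i * antipode k (Q.a j)) ⊗ₜ[k] (Q.b i * Q.b j) = 1 := by
  have h := congrArg (TensorProduct.map (LinearMap.mul' k H ∘ₗ (antipode k).lTensor H)
    LinearMap.id ∘ (TensorProduct.assoc k H H H).symm) Q.qt_rTensor
  simp only [Function.comp_apply, LinearEquiv.symm_apply_apply, map_sum, TensorProduct.map_tmul,
    LinearMap.comp_apply, mul_antipode_lTensor_comul_apply, Finset.sum_mul_sum,
    Algebra.TensorProduct.tmul_mul_tmul, mul_one, one_mul, TensorProduct.assoc_symm_tmul,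
    LinearMap.lTensor_tmul, LinearMap.mul'_apply, LinearMap.id_apply] at h
  rw [← h]
  simp only [Algebra.algebraMap_eq_smul_one, TensorProduct.smul_tmul, ← TensorProduct.tmul_sum,
    sum_counit_smul_b, Algebra.TensorProduct.one_def]

theorem sum_antipode_b_mul_b :
    ∑ i, ∑ j, (Q.a i * Q.a j) ⊗ₜ[k] (antipode k (Q.b j) * Q.b i) = 1 := by
  have h := congrArg (TensorProduct.map (LinearMap.id : H →ₗ[k] H)
    (LinearMap.mul' k H ∘ₗ (antipode k).rTensor H)) Q.qt_lTensor
  simp only [map_sum, TensorProduct.map_tmul,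
    LinearMap.comp_apply, mul_antipode_rTensor_comul_apply, Finset.sum_mul_sum,
    Algebra.TensorProduct.tmul_mul_tmul, mul_one, one_mul,
    LinearMap.rTensor_tmul, LinearMap.mul'_apply, LinearMap.id_apply] at h
  rw [← h]
  simp only [Algebra.algebraMap_eq_smul_one, ← TensorProduct.smul_tmul, ← TensorProduct.sum_tmul,
    sum_counit_smul_a, Algebra.TensorProduct.one_def]

theorem sum_b_mul_antipode_b :
    ∑ i, ∑ j, (Q.a i * Q.a j) ⊗ₜ[k] (Q.b j * antipode k (Q.b i)) = 1 := by
  have h := congrArg (TensorProduct.map (LinearMap.id : H →ₗ[k] H)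
    (LinearMap.mul' k H ∘ₗ (antipode k).lTensor H)) Q.qt_lTensor
  simp only [map_sum, TensorProduct.map_tmul,
    LinearMap.comp_apply, mul_antipode_lTensor_comul_apply, Finset.sum_mul_sum,
    Algebra.TensorProduct.tmul_mul_tmul, mul_one, one_mul,
    LinearMap.lTensor_tmul, LinearMap.mul'_apply, LinearMap.id_apply] at h
  rw [← h]
  simp only [Algebra.algebraMap_eq_smul_one, ← TensorProduct.smul_tmul, ← TensorProduct.sum_tmul,
    sum_counit_smul_a, Algebra.TensorProduct.one_def]

/-- The invariance `(S ⊗ S)(R) = R`. -/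
theorem sum_antipode_tmul_antipode :
    ∑ i, antipode k (Q.a i) ⊗ₜ[k] antipode k (Q.b i) = ∑ i, Q.a i ⊗ₜ[k] Q.b i := by
  have h1 : (∑ i, antipode k (Q.a i) ⊗ₜ[k] antipode k (Q.b i)) *
      ∑ i, antipode k (Q.a i) ⊗ₜ[k] Q.b i = 1 := by
    have h := congrArg ((antipode k (A := H)).rTensor H) Q.sum_antipode_b_mul_b
    rw [Finset.sum_comm] at h
    simpa [map_sum, antipode_mul_antidistrib, Finset.sum_mul_sum,
      Algebra.TensorProduct.one_def] using h
  have h2 : (∑ i, antipode k (Q.a i) ⊗ₜ[k] Q.b i) * ∑ i, Q.a i ⊗ₜ[k] Q.b i = 1 := by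
    simpa [Finset.sum_mul_sum] using Q.sum_antipode_a_mul_a
  exact left_inv_eq_right_inv h1 h2

theorem sum_antipode_antipode_a_mul_mul_antipode_b (c : H) :
    ∑ i, antipode k (antipode k (Q.a i)) * c * antipode k (Q.b i) =
      ∑ i, antipode k (Q.a i) * c * Q.b i := by
  simpa [map_sum] using congrArg (LinearMap.mul' k H ∘ₗ
    (LinearMap.mulRight k c ∘ₗ antipode k).rTensor H) Q.sum_antipode_tmul_antipode

end Counit

section Inverse

variable {E : Type*} [Ring E] [Algebra k E] (Q : QT k H) {f g : H →ₐ[k] E}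

theorem elInv_mul_el (hfg : ∀ x y, Commute (f x) (g y)) : Q.elInv f g * Q.el f g = 1 := by
  have h := congrArg (Algebra.TensorProduct.lift f g hfg) Q.sum_antipode_a_mul_a
  rw [map_one] at h
  rw [← h]
  simp only [elInv, el, Finset.sum_mul_sum, map_sum, Algebra.TensorProduct.lift_tmul, map_mul]
  exact Finset.sum_congr rfl fun i _ ↦ Finset.sum_congr rfl fun j _ ↦
    (hfg _ _).symm.mul_mul_mul_comm _ _

theorem el_mul_elInv (hfg : ∀ x y, Commute (f x) (g y)) : Q.el f g * Q.elInv f g = 1 := by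
  have h := congrArg (Algebra.TensorProduct.lift f g hfg) Q.sum_a_mul_antipode_a
  rw [map_one] at h
  rw [← h]
  simp only [elInv, el, Finset.sum_mul_sum, map_sum, Algebra.TensorProduct.lift_tmul, map_mul]
  exact Finset.sum_congr rfl fun i _ ↦ Finset.sum_congr rfl fun j _ ↦
    (hfg _ _).symm.mul_mul_mul_comm _ _

end Inverse

section Drinfeld

variable (Q : QT k H)

/-- The Drinfeld element `u = S(R₍₂₎) R₍₁₎`. -/
def u : H := ∑ i, antipode k (Q.b i) * Q.a i

theorem sum_antipode_mul_u_mul {h : H} {ι : Type*} (r : Coalgebra.Repr k h ι) :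
    ∑ i ∈ r.index, antipode k (r.right i) * (Q.u * r.left i) = counit (R := k) h • Q.u := by
  have key := congrArg (LinearMap.mul' k H ∘ₗ (antipode k).rTensor H ∘ₗ
    (TensorProduct.comm k H H).toLinearMap) (Q.qcc h)
  simp only [← r.eq, map_sum, Finset.sum_mul_sum, TensorProduct.comm_tmul,
    Algebra.TensorProduct.tmul_mul_tmul, LinearMap.comp_apply, LinearEquiv.coe_coe,
    LinearMap.rTensor_tmul, LinearMap.mul'_apply, antipode_mul_antidistrib] at key
  have h1 : ∑ i ∈ r.index, antipode k (r.right i) * (Q.u * r.left i) =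
      ∑ j, ∑ i ∈ r.index,
        antipode k (r.right i) * antipode k (Q.b j) * (Q.a j * r.left i) := by
    rw [Finset.sum_comm]
    simp [u, Finset.sum_mul, Finset.mul_sum, mul_assoc]
  have h2 : ∑ i ∈ r.index, ∑ j,
      antipode k (Q.b j) * antipode k (r.left i) * (r.right i * Q.a j) =
        counit (R := k) h • Q.u := by
    rw [Finset.sum_comm, u, Finset.smul_sum]
    refine Finset.sum_congr rfl fun j _ ↦ ?_
    have := congrArg (fun x ↦ antipode k (Q.b j) * x * Q.a j) (sum_antipode_mul_eq_smul r)
    simpa [Finset.sum_mul, Finset.mul_sum, mul_assoc] using this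
  rw [h1, key, h2]

theorem u_mul (h : H) : Q.u * h = antipode k (antipode k h) * Q.u := by
  let T : H ⊗[k] (H ⊗[k] H) →ₗ[k] H := LinearMap.mul' k H ∘ₗ
    TensorProduct.map (antipode k ∘ₗ LinearMap.mul' k H ∘ₗ (antipode k).lTensor H)
      (LinearMap.mulLeft k Q.u) ∘ₗ (TensorProduct.comm k _ _).toLinearMap
  have h0 := congrArg T (Coalgebra.coassoc_apply (R := k) h)
  have h1 : T (comul.lTensor H (comul (R := k) h)) = Q.u * h := by
    have := sum_tmul_counit_eq (R := k) (ℛ k h)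
    have := congrArg (TensorProduct.rid k H) this
    simp only [map_sum, TensorProduct.rid_tmul, one_smul] at this
    conv_rhs => rw [← this]
    conv_lhs => rw [← (ℛ k h).eq]
    simp [T, map_sum, Algebra.algebraMap_eq_smul_one, Finset.mul_sum]
  have h2 : T (TensorProduct.assoc k H H H (comul.rTensor H (comul (R := k) h))) =
      antipode k (antipode k h) * Q.u := by
    have key : ∀ x y : H, T (TensorProduct.assoc k H H H (comul (R := k) x ⊗ₜ y)) =
        antipode k (antipode k y) * (counit (R := k) x • Q.u) := by
      intro x y
      rw [← Q.sum_antipode_mul_u_mul (ℛ k x), ← (ℛ k x).eq]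
      simp [T, map_sum, TensorProduct.sum_tmul, antipode_mul_antidistrib, Finset.mul_sum,
        mul_assoc]
    conv_rhs => rw [← sum_counit_smul (R := k) (ℛ k h)]
    conv_lhs => rw [← (ℛ k h).eq]
    simp [map_sum, key, Finset.sum_mul]
  rw [← h1, ← h0, h2]

theorem u_mul_uinv : Q.u * Q.uinv = 1 := by
  have h : Q.u * Q.uinv = ∑ i, ∑ j, Q.b j * antipode k (Q.b i) * (Q.a i * Q.a j) := by
    rw [uinv, Finset.mul_sum, Finset.sum_comm]
    refine Finset.sum_congr rfl fun i _ ↦ ?_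
    rw [← mul_assoc, u_mul, Q.antipode_Sinv, Q.antipode_Sinv]
    simp [u, Finset.sum_mul, Finset.mul_sum, mul_assoc]
  rw [h]
  simpa [map_sum, Algebra.TensorProduct.one_def] using
    congrArg (LinearMap.mul' k H ∘ₗ (TensorProduct.comm k H H).toLinearMap) Q.sum_b_mul_antipode_b

variable [FiniteDimensional k H]

theorem uinv_mul_u : Q.uinv * Q.u = 1 := by
  have : IsNoetherianRing H := IsNoetherianRing.of_finite k H
  exact mul_eq_one_symm Q.u_mul_uinv

theorem uinv_mul (h : H) : Q.uinv * antipode k (antipode k h) = h * Q.uinv := by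
  calc Q.uinv * antipode k (antipode k h)
      = Q.uinv * (antipode k (antipode k h) * Q.u) * Q.uinv := by
        rw [mul_assoc, mul_assoc, Q.u_mul_uinv, mul_one]
    _ = h * Q.uinv := by rw [← Q.u_mul, ← mul_assoc, Q.uinv_mul_u, one_mul]

theorem sum_b_mul_uinv_mul_antipode_a : ∑ i, Q.b i * Q.uinv * antipode k (Q.a i) = 1 := by
  have h := congrArg (LinearMap.mul' k H ∘ₗ (antipode k).rTensor H ∘ₗ
    (TensorProduct.comm k H H).toLinearMap) Q.sum_antipode_tmul_antipode
  simp only [map_sum, LinearMap.comp_apply, LinearEquiv.coe_coe, TensorProduct.comm_tmul,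
    LinearMap.rTensor_tmul, LinearMap.mul'_apply] at h
  rw [← Q.uinv_mul_u, u, ← h, Finset.mul_sum]
  simp only [← mul_assoc, uinv_mul]

theorem sum_antipode_a_mul_antipode_uinv_mul_b :
    ∑ i, antipode k (Q.a i) * antipode k Q.uinv * Q.b i = 1 := by
  rw [← Q.sum_antipode_antipode_a_mul_mul_antipode_b]
  simpa [map_sum, antipode_mul_antidistrib, mul_assoc] using
    congrArg (antipode k) Q.sum_b_mul_uinv_mul_antipode_a

end Drinfeld

section BraidedCoproduct

open Algebra.TensorProduct (includeLeft includeRight)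

variable (Q : QT k H)

theorem brComul_eq (h : H) : Q.brComul h = ∑ j, (1 ⊗ₜ[k] antipode k (Q.b j)) *
    ((∑ i, Q.a i ⊗ₜ[k] Q.b i) * comul (R := k) h) * (Q.a j ⊗ₜ[k] 1) := by
  have key : ∀ (x y z : H) (t : H ⊗[k] H),
      TensorProduct.map (LinearMap.mulLeft k x ∘ₗ LinearMap.mulRight k y)
        (LinearMap.mulLeft k z) t = (x ⊗ₜ[k] z) * t * (y ⊗ₜ[k] 1) := by
    intro x y z t
    induction t with
    | zero => simp
    | tmul t s => simp [mul_assoc]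
    | add t s ht hs => simp only [map_add, ht, hs, mul_add, add_mul]
  rw [brComul, Finset.sum_comm]
  simp only [key, Finset.sum_mul, Finset.mul_sum, ← mul_assoc,
    Algebra.TensorProduct.tmul_mul_tmul, one_mul]

theorem brComul_smul (c : k) (x : H) : Q.brComul (c • x) = c • Q.brComul x := by
  simp [brComul, Finset.smul_sum]

theorem brComul_sum {ι : Type*} (s : Finset ι) (x : ι → H) :
    Q.brComul (∑ i ∈ s, x i) = ∑ i ∈ s, Q.brComul (x i) := by
  simp only [brComul_eq, map_sum, Finset.mul_sum, Finset.sum_mul]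
  rw [Finset.sum_comm]

/-- The identity `(id ⊗ Δ̲)(R R₂₁) = R₁₂ R₂₁ R₁₃ R₃₁`. -/
theorem sum_tmul_brComul :
    ∑ i, ∑ j, (Q.a i * Q.b j) ⊗ₜ[k] Q.brComul (Q.b i * Q.a j) =
      ∑ i, ∑ j, ∑ l, ∑ n, (Q.a i * Q.b j * (Q.a l * Q.b n)) ⊗ₜ[k]
        ((Q.b i * Q.a j) ⊗ₜ[k] (Q.b l * Q.a n)) := by
  let f₀ : H →ₐ[k] H ⊗[k] (H ⊗[k] H) := includeLeft
  let f₁ : H →ₐ[k] H ⊗[k] (H ⊗[k] H) := includeRight.comp includeLeft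
  let f₂ : H →ₐ[k] H ⊗[k] (H ⊗[k] H) := includeRight.comp includeRight
  let D : H →ₐ[k] H ⊗[k] (H ⊗[k] H) := includeRight.comp (Bialgebra.comulAlgHom k H)
  have h01 : ∀ x y, Commute (f₀ x) (f₁ y) := fun x y ↦ by simp [Commute, SemiconjBy, f₀, f₁]
  have h02 : ∀ x y, Commute (f₀ x) (f₂ y) := fun x y ↦ by simp [Commute, SemiconjBy, f₀, f₂]
  have h12 : ∀ x y, Commute (f₁ x) (f₂ y) := fun x y ↦ by simp [Commute, SemiconjBy, f₁, f₂]
  have h0D : ∀ x y, Commute (f₀ x) (D y) := fun x y ↦ by simp [Commute, SemiconjBy, f₀, D]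
  have h10 := fun x y ↦ (h01 y x).symm
  have h20 := fun x y ↦ (h02 y x).symm
  have hD : ∀ x, Algebra.TensorProduct.lift f₁ f₂ h12 (comul (R := k) x) = D x := by
    intro x
    have : Algebra.TensorProduct.lift f₁ f₂ h12 = includeRight := by
      ext <;> simp [f₁, f₂]
    simp [this, D]
  have hL : ∑ i, f₀ (Q.a i) * D (Q.b i) = Q.el f₀ f₂ * Q.el f₀ f₁ := by
    simpa only [hD] using Q.sum_mul_lift_comul h01 h02 h12
  have hR : ∑ i, D (Q.a i) * f₀ (Q.b i) = Q.el f₁ f₀ * Q.el f₂ f₀ := by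
    simpa only [hD] using Q.sum_lift_comul_mul h12 h10 h20
  have hlhs : ∑ i, ∑ j, (Q.a i * Q.b j) ⊗ₜ[k] Q.brComul (Q.b i * Q.a j) =
      ∑ n, f₂ (antipode k (Q.b n)) * (Q.el f₁ f₂ *
        (Q.el f₀ f₂ * Q.el f₀ f₁ * (Q.el f₁ f₀ * Q.el f₂ f₀))) * f₁ (Q.a n) := by
    have h1 : ∀ x y, x ⊗ₜ[k] Q.brComul y = ∑ n, f₂ (antipode k (Q.b n)) *
        (Q.el f₁ f₂ * (f₀ x * D y)) * f₁ (Q.a n) := by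
      intro x y
      have h2 : Q.el f₁ f₂ = (1 : H) ⊗ₜ[k] (∑ i, Q.a i ⊗ₜ[k] Q.b i) := by
        simp [el, f₁, f₂, TensorProduct.tmul_sum]
      rw [h2, brComul_eq]
      generalize ∑ i, Q.a i ⊗ₜ[k] Q.b i = r
      simp [f₀, f₁, f₂, D, TensorProduct.tmul_sum]
    simp only [h1, map_mul]
    refine ((Finset.sum_congr rfl fun i _ ↦ Finset.sum_comm).trans Finset.sum_comm).trans
      (Finset.sum_congr rfl fun n _ ↦ ?_)
    rw [← hL, ← hR, Finset.sum_mul_sum]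
    simp only [Finset.mul_sum, Finset.sum_mul]
    refine Finset.sum_congr rfl fun i _ ↦ Finset.sum_congr rfl fun j _ ↦ ?_
    rw [(h0D _ _).mul_mul_mul_comm, (h0D (Q.b j) _).eq]
  have hybe : Q.el f₁ f₂ * (Q.el f₀ f₂ * Q.el f₀ f₁ * (Q.el f₁ f₀ * Q.el f₂ f₀)) =
      (Q.el f₀ f₁ * Q.el f₁ f₀) * Q.el f₁ f₂ * (Q.el f₀ f₂ * Q.el f₂ f₀) := by
    have y1 := Q.yang_baxter h01 h02 h12
    have y2 := Q.yang_baxter h10 h12 h02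
    calc _ = (Q.el f₁ f₂ * Q.el f₀ f₂ * Q.el f₀ f₁) * Q.el f₁ f₀ * Q.el f₂ f₀ := by
          simp only [mul_assoc]
      _ = Q.el f₀ f₁ * (Q.el f₀ f₂ * Q.el f₁ f₂ * Q.el f₁ f₀) * Q.el f₂ f₀ := by
          rw [← y1]; simp only [mul_assoc]
      _ = _ := by rw [← y2]; simp only [mul_assoc]
  have hc2 : ∀ x, Commute (f₂ x) (Q.el f₀ f₁ * Q.el f₁ f₀) := fun x ↦
    (Commute.sum_right _ _ _ fun i _ ↦ (h20 _ _).mul_right (h12 _ _).symm).mul_right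
      (Commute.sum_right _ _ _ fun i _ ↦ (h12 _ _).symm.mul_right (h20 _ _))
  have hc1 : ∀ x, Commute (Q.el f₀ f₂ * Q.el f₂ f₀) (f₁ x) := fun x ↦
    (Commute.sum_left _ _ _ fun i _ ↦ (h01 _ _).mul_left (h12 _ _).symm).mul_left
      (Commute.sum_left _ _ _ fun i _ ↦ (h12 _ _).symm.mul_left (h01 _ _))
  have hone : ∑ n, f₂ (antipode k (Q.b n)) * Q.el f₁ f₂ * f₁ (Q.a n) = 1 := by
    have h := congrArg (Algebra.TensorProduct.lift f₁ f₂ h12) Q.sum_antipode_b_mul_b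
    rw [map_one, Finset.sum_comm] at h
    rw [← h]
    simp only [el, Finset.mul_sum, Finset.sum_mul, map_sum, Algebra.TensorProduct.lift_tmul,
      map_mul]
    refine Finset.sum_congr rfl fun n _ ↦ Finset.sum_congr rfl fun i _ ↦ ?_
    rw [← mul_assoc, ← (h12 (Q.a i) _).eq, mul_assoc, mul_assoc, ← (h12 _ _).eq, ← mul_assoc,
      ← mul_assoc, mul_assoc (f₁ (Q.a i)), ← (h12 _ _).eq]
    simp only [mul_assoc]
  have hrhs : ∑ n, f₂ (antipode k (Q.b n)) * (Q.el f₁ f₂ *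
        (Q.el f₀ f₂ * Q.el f₀ f₁ * (Q.el f₁ f₀ * Q.el f₂ f₀))) * f₁ (Q.a n) =
      (Q.el f₀ f₁ * Q.el f₁ f₀) * (Q.el f₀ f₂ * Q.el f₂ f₀) := by
    rw [hybe]
    calc _ = ∑ n, (Q.el f₀ f₁ * Q.el f₁ f₀) *
          (f₂ (antipode k (Q.b n)) * Q.el f₁ f₂ * f₁ (Q.a n)) *
            (Q.el f₀ f₂ * Q.el f₂ f₀) := by
          refine Finset.sum_congr rfl fun n _ ↦ ?_
          rw [mul_assoc _ _ (f₁ _), mul_assoc _ _ (f₁ _), (hc1 _).eq, ← mul_assoc (f₂ _),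
            ← mul_assoc (f₂ _), (hc2 _).eq]
          simp only [mul_assoc]
      _ = _ := by rw [← Finset.sum_mul, ← Finset.mul_sum, hone, mul_one]
  rw [hlhs, hrhs]
  simp only [el, f₀, f₁, f₂, Finset.sum_mul_sum, AlgHom.comp_apply,
    Algebra.TensorProduct.includeLeft_apply, Algebra.TensorProduct.includeRight_apply,
    Algebra.TensorProduct.tmul_mul_tmul, one_mul, mul_one]
  exact Finset.sum_congr rfl fun i _ ↦ Finset.sum_comm

theorem sum_phi_tmul_phi (φ : Module.Dual k H) (N : ℕ) (p q : Fin N → Module.Dual k H)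
    (hpq : ∀ x y : H, ∑ j, p j x * q j y = φ (x * y)) :
    ∑ j, Q.toRMat.phi (p j) ⊗ₜ[k] Q.toRMat.phi (q j) = Q.brComul (Q.toRMat.phi φ) := by
  have h := congrArg ((TensorProduct.lid k (H ⊗[k] H)).toLinearMap ∘ₗ φ.rTensor (H ⊗[k] H))
    Q.sum_tmul_brComul
  simp only [map_sum, LinearMap.comp_apply, LinearEquiv.coe_coe, LinearMap.rTensor_tmul,
    TensorProduct.lid_tmul, ← hpq (_ * _) (_ * _)] at h
  have hpure : ∀ x, Q.toRMat.phi (p x) ⊗ₜ[k] Q.toRMat.phi (q x) = ∑ i, ∑ j, ∑ l, ∑ n,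
      (p x (Q.a i * Q.b j) * q x (Q.a l * Q.b n)) •
        ((Q.b i * Q.a j) ⊗ₜ[k] (Q.b l * Q.a n)) := by
    intro x
    simp only [RMat.phi, TensorProduct.sum_tmul]
    simp only [TensorProduct.tmul_sum, TensorProduct.tmul_smul, ← TensorProduct.smul_tmul',
      smul_smul, mul_comm]
  simp only [hpure]
  simp only [RMat.phi, brComul_sum, brComul_smul]
  rw [h, Finset.sum_comm]
  refine Finset.sum_congr rfl fun i _ ↦ ?_
  rw [Finset.sum_comm]
  refine Finset.sum_congr rfl fun j _ ↦ ?_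
  rw [Finset.sum_comm]
  refine Finset.sum_congr rfl fun l _ ↦ ?_
  rw [Finset.sum_comm]
  refine Finset.sum_congr rfl fun n _ ↦ ?_
  rw [Finset.sum_smul]

end BraidedCoproduct

section BraidedAntipode

open Algebra.TensorProduct (includeLeft includeRight)

variable (Q : QT k H) [FiniteDimensional k H]

/-- Contracting `R R₂₁` with `S_L` in the first factor gives `R₂₁⁻¹ R⁻¹`. -/
theorem sum_sL_tensor :
    ∑ i, ∑ j, ∑ l, (Q.b l * Q.uinv * (antipode k (Q.a i * Q.b j) * antipode k (Q.a l))) ⊗ₜ[k]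
      (Q.b i * Q.a j) =
    ∑ i, ∑ j, (Q.b i * antipode k (Q.a j)) ⊗ₜ[k] (antipode k (Q.a i) * Q.b j) := by
  let f₁ : H →ₐ[k] Module.End k (H ⊗[k] H) := (Algebra.lmul k (H ⊗[k] H)).comp includeLeft
  let f₂ : H →ₐ[k] Module.End k (H ⊗[k] H) := (Algebra.lmul k (H ⊗[k] H)).comp includeRight
  let f₃ : H →ₐ[k] Module.End k (H ⊗[k] H) := AlgHom.ofLinearMap
    ((LinearMap.mul k (H ⊗[k] H)).flip ∘ₗ includeLeft.toLinearMap ∘ₗ antipode k)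
    (by ext; simp) (fun x y ↦ by ext; simp [antipode_mul_antidistrib, mul_assoc])
  have a1 : ∀ x y z, f₁ x (y ⊗ₜ z) = (x * y) ⊗ₜ z := fun x y z ↦ by simp [f₁]
  have a2 : ∀ x y z, f₂ x (y ⊗ₜ z) = y ⊗ₜ (x * z) := fun x y z ↦ by simp [f₂]
  have a3 : ∀ x y z, f₃ x (y ⊗ₜ z) = (y * antipode k x) ⊗ₜ z := fun x y z ↦ by simp [f₃]
  have h21 : ∀ x y, Commute (f₂ x) (f₁ y) := fun x y ↦ TensorProduct.ext' fun s t ↦ by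
    simp [a1, a2]
  have h31 : ∀ x y, Commute (f₃ x) (f₁ y) := fun x y ↦ TensorProduct.ext' fun s t ↦ by
    simp [a1, a3, mul_assoc]
  have h32 : ∀ x y, Commute (f₃ x) (f₂ y) := fun x y ↦ TensorProduct.ext' fun s t ↦ by
    simp [a2, a3]
  have h23 := fun x y ↦ (h32 y x).symm
  have hybe : Q.el f₃ f₁ * Q.el f₃ f₂ * Q.el f₂ f₃ =
      Q.elInv f₂ f₁ * (Q.el f₃ f₂ * (Q.el f₂ f₃ * Q.el f₂ f₁ * Q.el f₃ f₁)) := by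
    have y1 := Q.yang_baxter h32 h31 h21
    have y2 := Q.yang_baxter h23 h21 h31
    calc _ = Q.elInv f₂ f₁ * (Q.el f₂ f₁ * Q.el f₃ f₁ * Q.el f₃ f₂) * Q.el f₂ f₃ := by
          simp only [← mul_assoc, Q.elInv_mul_el h21, one_mul]
      _ = Q.elInv f₂ f₁ * (Q.el f₃ f₂ * (Q.el f₃ f₁ * Q.el f₂ f₁ * Q.el f₂ f₃)) := by
          rw [← y1]; simp only [mul_assoc]
      _ = _ := by rw [← y2]
  have e1 : Q.el f₃ f₁ (Q.uinv ⊗ₜ 1) = 1 ⊗ₜ 1 := by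
    refine Eq.trans ?_ (congrArg (· ⊗ₜ[k] (1 : H)) Q.sum_b_mul_uinv_mul_antipode_a)
    simp [el, a1, a3, TensorProduct.sum_tmul]
  have e2 : (Q.el f₂ f₃ * Q.el f₂ f₁) (1 ⊗ₜ 1) = 1 ⊗ₜ 1 := by
    have := congrArg (TensorProduct.comm k H H) Q.sum_b_mul_antipode_b
    simp only [map_sum, TensorProduct.comm_tmul, Algebra.TensorProduct.one_def] at this
    refine Eq.trans ?_ this
    simp [el, Finset.sum_mul_sum, a1, a2, a3]
  have h := LinearMap.congr_fun hybe (Q.uinv ⊗ₜ 1)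
  simp only [Module.End.mul_apply] at h e2
  rw [e1, e2] at h
  rw [Finset.sum_comm, Finset.sum_comm (f := fun i j ↦ (Q.b i * _) ⊗ₜ[k] _)]
  simpa [el, elInv, a1, a2, a3, antipode_mul_antidistrib, mul_assoc] using h

/-- Contracting `R R₂₁` with the braided antipode in the second factor gives `R₂₁⁻¹ R⁻¹`. -/
theorem sum_brS_tensor :
    ∑ i, ∑ j, ∑ l, (Q.a i * Q.b j) ⊗ₜ[k]
      antipode k (Q.b l * Q.uinv * (Q.b i * Q.a j) * antipode k (Q.a l)) =
    ∑ i, ∑ j, (Q.b i * antipode k (Q.a j)) ⊗ₜ[k] (antipode k (Q.a i) * Q.b j) := by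
  let f₁ : H →ₐ[k] (Module.End k (H ⊗[k] H))ᵐᵒᵖ := AlgHom.ofLinearMap
    ((opLinearEquiv k).toLinearMap ∘ₗ (LinearMap.mul k (H ⊗[k] H)).flip ∘ₗ
      includeLeft.toLinearMap)
    (unop_injective (by ext; simp)) (fun x y ↦ unop_injective (by ext; simp [mul_assoc]))
  let f₂ : H →ₐ[k] (Module.End k (H ⊗[k] H))ᵐᵒᵖ := AlgHom.ofLinearMap
    ((opLinearEquiv k).toLinearMap ∘ₗ LinearMap.mul k (H ⊗[k] H) ∘ₗ
      includeRight.toLinearMap ∘ₗ antipode k)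
    (unop_injective (by ext; simp))
    (fun x y ↦ unop_injective (by ext; simp [antipode_mul_antidistrib, mul_assoc]))
  let f₃ : H →ₐ[k] (Module.End k (H ⊗[k] H))ᵐᵒᵖ := AlgHom.ofLinearMap
    ((opLinearEquiv k).toLinearMap ∘ₗ (LinearMap.mul k (H ⊗[k] H)).flip ∘ₗ
      includeRight.toLinearMap)
    (unop_injective (by ext; simp)) (fun x y ↦ unop_injective (by ext; simp [mul_assoc]))
  have a1 : ∀ x y z, (f₁ x).unop (y ⊗ₜ z) = (y * x) ⊗ₜ z := fun x y z ↦ by simp [f₁]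
  have a2 : ∀ x y z, (f₂ x).unop (y ⊗ₜ z) = y ⊗ₜ (antipode k x * z) := fun x y z ↦ by simp [f₂]
  have a3 : ∀ x y z, (f₃ x).unop (y ⊗ₜ z) = y ⊗ₜ (z * x) := fun x y z ↦ by simp [f₃]
  have h12 : ∀ x y, Commute (f₁ x) (f₂ y) := fun x y ↦
    unop_injective (TensorProduct.ext' fun s t ↦ by simp [a1, a2])
  have h13 : ∀ x y, Commute (f₁ x) (f₃ y) := fun x y ↦
    unop_injective (TensorProduct.ext' fun s t ↦ by simp [a1, a3])
  have h23 : ∀ x y, Commute (f₂ x) (f₃ y) := fun x y ↦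
    unop_injective (TensorProduct.ext' fun s t ↦ by simp [a2, a3, mul_assoc])
  have h21 := fun x y ↦ (h12 y x).symm
  have hybe : Q.el f₁ f₂ * (Q.el f₂ f₁ * Q.el f₂ f₃) =
      Q.el f₂ f₃ * (Q.el f₁ f₃ * Q.el f₁ f₂) * Q.el f₂ f₁ * Q.elInv f₁ f₃ := by
    have y1 := Q.yang_baxter h12 h13 h23
    have y2 := Q.yang_baxter h21 h23 h13
    calc _ = Q.el f₁ f₂ * (Q.el f₂ f₁ * Q.el f₂ f₃ * Q.el f₁ f₃) * Q.elInv f₁ f₃ := by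
          simp only [mul_assoc, Q.el_mul_elInv h13, mul_one]
      _ = (Q.el f₁ f₂ * Q.el f₁ f₃ * Q.el f₂ f₃) * Q.el f₂ f₁ * Q.elInv f₁ f₃ := by
          rw [y2]; simp only [mul_assoc]
      _ = _ := by rw [y1]; simp only [mul_assoc]
  have e1 : (Q.el f₂ f₃).unop (1 ⊗ₜ antipode k Q.uinv) = 1 ⊗ₜ 1 := by
    refine Eq.trans ?_ (congrArg ((1 : H) ⊗ₜ[k] ·) Q.sum_antipode_a_mul_antipode_uinv_mul_b)
    simp [el, a2, a3, TensorProduct.tmul_sum, mul_assoc]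
  have e2 : (Q.el f₁ f₃ * Q.el f₁ f₂).unop (1 ⊗ₜ 1) = 1 ⊗ₜ 1 := by
    refine Eq.trans ?_ Q.sum_antipode_b_mul_b
    simp [el, Finset.sum_mul_sum, a1, a2, a3]
  have h := LinearMap.congr_fun (congrArg unop hybe) (1 ⊗ₜ antipode k Q.uinv)
  simp only [unop_mul, Module.End.mul_apply] at h e2
  rw [e1, e2] at h
  have hinv : ∀ i j, ∑ l, (Q.a i * Q.b j) ⊗ₜ[k]
      antipode k (Q.b l * Q.uinv * (Q.b i * Q.a j) * antipode k (Q.a l)) =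
      ∑ l, (Q.a i * Q.b j) ⊗ₜ[k] (antipode k (Q.a l) *
        (antipode k (Q.a j) * (antipode k (Q.b i) * antipode k Q.uinv)) * Q.b l) := by
    intro i j
    rw [← TensorProduct.tmul_sum, ← TensorProduct.tmul_sum,
      ← Q.sum_antipode_antipode_a_mul_mul_antipode_b]
    simp only [antipode_mul_antidistrib, mul_assoc]
  simp only [hinv]
  simpa [el, elInv, a1, a2, a3] using h

theorem phi_sL (φ : Module.Dual k H) : Q.toRMat.phi (Q.sL φ) = Q.brS (Q.toRMat.phi φ) := by
  have h := congrArg ((TensorProduct.lid k H).toLinearMap ∘ₗ φ.rTensor H)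
    (Q.sum_sL_tensor.trans Q.sum_brS_tensor.symm)
  simp only [map_sum, LinearMap.comp_apply, LinearEquiv.coe_coe, LinearMap.rTensor_tmul,
    TensorProduct.lid_tmul] at h
  have hL : Q.toRMat.phi (Q.sL φ) = ∑ i, ∑ j, ∑ l, φ (Q.b l * Q.uinv *
      (antipode k (Q.a i * Q.b j) * antipode k (Q.a l))) • (Q.b i * Q.a j) := by
    simp [RMat.phi, sL, Finset.sum_smul, mul_assoc]
  have hR : Q.brS (Q.toRMat.phi φ) = ∑ i, ∑ j, ∑ l, φ (Q.a i * Q.b j) •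
      antipode k (Q.b l * Q.uinv * (Q.b i * Q.a j) * antipode k (Q.a l)) := by
    simp only [RMat.phi, brS, Finset.mul_sum, Finset.sum_mul, map_sum, mul_smul_comm,
      smul_mul_assoc, map_smul]
    rw [Finset.sum_comm]
    exact Finset.sum_congr rfl fun i _ ↦ Finset.sum_comm
  rw [hL, hR, h]

end BraidedAntipode

end QT

theorem statement14
    {k H : Type*} [Field k] [Ring H] [HopfAlgebra k H] [FiniteDimensional k H]
    (Q : QT k H) (φ : Module.Dual k H) :
    -- `(Φ₀,₁ ⊗ Φ₀,₁)(Δ_{H*}(φ)) = Δ̲(Φ₀,₁(φ))`, where `Δ_{H*}(φ) = Σ_j p j ⊗ q j` is any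
    -- representation of the dual coproduct, i.e. `Σ_j (p j)(x)·(q j)(y) = φ(x·y)`:
    (∀ (N : ℕ) (p q : Fin N → Module.Dual k H),
      (∀ x y : H, ∑ j, p j x * q j y = φ (x * y)) →
      ∑ j, Q.toRMat.phi (p j) ⊗ₜ[k] Q.toRMat.phi (q j) = Q.brComul (Q.toRMat.phi φ)) ∧
    -- `Φ₀,₁(S_L(φ)) = S̲(Φ₀,₁(φ))`:
    Q.toRMat.phi (Q.sL φ) = Q.brS (Q.toRMat.phi φ) := by
  exact ⟨Q.sum_phi_tmul_phi φ, Q.phi_sL φ⟩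

end
end
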